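/- arXiv:0805.2872 — 6 statements merged into one kernel-verified Lean document; each statement's English description precedes it below -/
import Mathlib

section
/- Let n ≥ 1 and let ℓ ∈ ℂⁿ be a nonzero vector, and set H = {u ∈ ℂⁿ : Σⱼ ℓⱼ uⱼ = 0}. Then the following are equivalent: (i) the ℝ-linear map H → ℝⁿ, u ↦ (Re u₁, …, Re uₙ), is not surjective; (ii) the ℝ-linear map H → ℝⁿ, u ↦ (Im u₁, …, Im uₙ), is not surjective; (iii) there exists λ ∈ ℂ∖{0} such that λ·ℓ ∈ ℝⁿ (i.e. every coordinate of λ·ℓ is real). -/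
open ComplexConjugate in
/-- Two complex numbers that are linearly independent over `ℝ` span `ℂ` over `ℝ`. -/
theorem Complex.exists_real_combination {p q : ℂ} (h : (conj p * q).im ≠ 0) (w : ℂ) :
    ∃ a b : ℝ, (a : ℂ) * p + b * q = w := by
  refine ⟨-(conj q * w).im / (conj p * q).im, (conj p * w).im / (conj p * q).im, ?_⟩
  simp only [Complex.mul_im, Complex.conj_re, Complex.conj_im] at h ⊢
  apply Complex.ext
  · simp only [Complex.add_re, Complex.re_ofReal_mul]
    rw [div_mul_eq_mul_div, div_mul_eq_mul_div, ← add_div, div_eq_iff h]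
    ring
  · simp only [Complex.add_im, Complex.im_ofReal_mul]
    rw [div_mul_eq_mul_div, div_mul_eq_mul_div, ← add_div, div_eq_iff h]
    ring

/-- If no nonzero complex multiple of `ℓ` is real, every real vector is the real part of a point
of the hyperplane with normal vector `ℓ`. -/
theorem exists_mem_hyperplane_re_eq {ι : Type*} [Fintype ι] {ℓ : ι → ℂ} (hℓ : ℓ ≠ 0)
    (h : ¬ ∃ c : ℂ, c ≠ 0 ∧ ∀ j, (c * ℓ j).im = 0) (x : ι → ℝ) :
    ∃ u : ι → ℂ, ∑ j, ℓ j * u j = 0 ∧ ∀ j, (u j).re = x j := by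
  classical
  obtain ⟨k, hk⟩ := Function.ne_iff.mp hℓ
  push Not at h
  obtain ⟨m, hm⟩ := h (starRingEnd ℂ (ℓ k)) ((map_ne_zero _).mpr hk)
  obtain ⟨a, b, hab⟩ := Complex.exists_real_combination hm (Complex.I * ∑ j, ℓ j * x j)
  let y : ι → ℝ := Pi.single k a + Pi.single m b
  have hy : ∑ j, ℓ j * (y j : ℂ) = Complex.I * ∑ j, ℓ j * x j := by
    rw [← hab]
    simp [y, Pi.single_apply, mul_add, Finset.sum_add_distrib, apply_ite Complex.ofReal, mul_comm]
  refine ⟨fun j => x j + Complex.I * y j, ?_, fun j => by simp⟩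
  have : ∑ j, ℓ j * (x j + Complex.I * y j)
      = ∑ j, ℓ j * (x j : ℂ) + Complex.I * ∑ j, ℓ j * (y j : ℂ) := by
    rw [Finset.mul_sum, ← Finset.sum_add_distrib]
    exact Finset.sum_congr rfl fun j _ => by ring
  rw [this, hy, ← mul_assoc, Complex.I_mul_I]
  ring

/-- If a nonzero complex multiple of `ℓ` is real, the real parts of the points of the hyperplane
with normal vector `ℓ` do not exhaust the real vectors. -/
theorem not_forall_exists_mem_hyperplane_re_eq {ι : Type*} [Fintype ι] {ℓ : ι → ℂ} (hℓ : ℓ ≠ 0)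
    {c : ℂ} (hc : c ≠ 0) (h : ∀ j, (c * ℓ j).im = 0) :
    ¬ ∀ x : ι → ℝ, ∃ u : ι → ℂ, ∑ j, ℓ j * u j = 0 ∧ ∀ j, (u j).re = x j := by
  classical
  intro hsurj
  obtain ⟨k, hk⟩ := Function.ne_iff.mp hℓ
  obtain ⟨u, hu, hre⟩ := hsurj (Pi.single k 1)
  have hsum : (∑ j, c * ℓ j * u j).re = 0 := by
    simp only [mul_assoc, ← Finset.mul_sum, hu, mul_zero, Complex.zero_re]
  have hre_k : (c * ℓ k).re = 0 := by
    simpa only [Complex.re_sum, Complex.mul_re (c * ℓ _), h, hre, zero_mul, sub_zero,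
      Pi.single_apply, mul_ite, mul_one, mul_zero, Finset.sum_ite_eq', Finset.mem_univ,
      if_true] using hsum
  exact mul_ne_zero hc hk (Complex.ext hre_k (h k))

/-- Multiplication by `±i` exchanges real and imaginary parts on a complex hyperplane. -/
theorem forall_exists_mem_hyperplane_re_eq_iff_im {ι : Type*} [Fintype ι] (ℓ : ι → ℂ) :
    (∀ x : ι → ℝ, ∃ u : ι → ℂ, ∑ j, ℓ j * u j = 0 ∧ ∀ j, (u j).re = x j) ↔
      ∀ x : ι → ℝ, ∃ u : ι → ℂ, ∑ j, ℓ j * u j = 0 ∧ ∀ j, (u j).im = x j := by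
  have hmul (z : ℂ) {u : ι → ℂ} (hu : ∑ j, ℓ j * u j = 0) : ∑ j, ℓ j * (z * u j) = 0 := by
    simp only [mul_left_comm _ z, ← Finset.mul_sum, hu, mul_zero]
  refine forall_congr' fun x => ⟨?_, ?_⟩
  · rintro ⟨u, hu, hx⟩
    exact ⟨fun j => Complex.I * u j, hmul _ hu, fun j => by simp [hx]⟩
  · rintro ⟨u, hu, hx⟩
    exact ⟨fun j => -Complex.I * u j, hmul _ hu, fun j => by simp [hx]⟩

/-- For a complex hyperplane `H = {u : Σ ℓⱼ uⱼ = 0}` with nonzero normal vector `ℓ`,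
the real-part projection `H → ℝⁿ` fails to be surjective iff the imaginary-part
projection fails to be surjective iff `ℓ` is a complex multiple of a real vector
(i.e. its class lies in `ℝℙⁿ⁻¹`). -/
theorem hyperplane_re_im_proj_tfae (n : ℕ) (hn : 1 ≤ n) (ℓ : Fin n → ℂ) (hℓ : ℓ ≠ 0)
    (H : Set (Fin n → ℂ)) (hH : H = {u : Fin n → ℂ | ∑ j, ℓ j * u j = 0}) :
    [¬ (∀ x : Fin n → ℝ, ∃ u ∈ H, ∀ j, (u j).re = x j),
     ¬ (∀ x : Fin n → ℝ, ∃ u ∈ H, ∀ j, (u j).im = x j),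
     ∃ c : ℂ, c ≠ 0 ∧ ∀ j, (c * ℓ j).im = 0].TFAE := by
  subst hH
  tfae_have 1 ↔ 2 := not_congr (forall_exists_mem_hyperplane_re_eq_iff_im ℓ)
  tfae_have 1 → 3 := fun h => by
    by_contra h'
    exact h (exists_mem_hyperplane_re_eq hℓ h')
  tfae_have 3 → 1 := fun ⟨_, hc, h⟩ => not_forall_exists_mem_hyperplane_re_eq hℓ hc h
  tfae_finish
end

section
/- Let n ≥ 1, let f be a polynomial in n complex variables, and let z ∈ (ℂ∖{0})ⁿ be a point with f(z) = 0 and (∂f/∂z₁(z), …, ∂f/∂zₙ(z)) ≠ 0. Let T = {v ∈ ℂⁿ : Σⱼ (∂f/∂zⱼ)(z)·vⱼ = 0} be the tangent space to the hypersurface V = {f = 0} at z. Then the following are equivalent: (i) the ℝ-linear map T → ℝⁿ, v ↦ (Re(v₁/z₁), …, Re(vₙ/zₙ)) (the differential of Log restricted to V at z), is not surjective; (ii) the ℝ-linear map T → ℝⁿ, v ↦ (Im(v₁/z₁), …, Im(vₙ/zₙ)) (the differential of Arg restricted to V at z), is not surjective; (iii) there exists λ ∈ ℂ∖{0} such that λ·(z₁·∂f/∂z₁(z),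 …, zₙ·∂f/∂zₙ(z)) ∈ ℝⁿ. -/
/-- Real linear combinations of complex numbers that do not all lie on one real line
through the origin fill the plane. -/
theorem exists_real_combination_eq {ι : Type*} [Fintype ι] (g : ι → ℂ) (hg : g ≠ 0)
    (h : ¬ ∃ c : ℂ, c ≠ 0 ∧ ∀ j, (c * g j).im = 0) (t : ℂ) :
    ∃ y : ι → ℝ, ∑ j, g j * (y j : ℂ) = t := by
  classical
  obtain ⟨k, hk⟩ := Function.ne_iff.mp hg
  have hc : (starRingEnd ℂ) (g k) ≠ 0 := by simpa using hk
  push Not at h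
  obtain ⟨j, hj⟩ := h _ hc
  set D := ((starRingEnd ℂ) (g k) * g j).im with hD
  refine ⟨Pi.single k (((starRingEnd ℂ) t * g j).im / D) +
    Pi.single j (((starRingEnd ℂ) (g k) * t).im / D), ?_⟩
  have hsingle (i : ι) (a : ℝ) : ∑ l, g l * ((Pi.single i a : ι → ℝ) l : ℂ) = g i * a := by
    rw [Finset.sum_eq_single i]
    · simp
    · intro l _ hl
      simp [hl]
    · simp
  simp only [Pi.add_apply, Complex.ofReal_add, mul_add, Finset.sum_add_distrib, hsingle]
  simp only [Complex.mul_im, Complex.conj_re, Complex.conj_im] at hD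
  apply Complex.ext <;>
    simp only [Complex.add_re, Complex.add_im, Complex.re_mul_ofReal, Complex.im_mul_ofReal] <;>
    simp only [Complex.mul_im, Complex.conj_re, Complex.conj_im] <;>
    field_simp <;> rw [hD] <;> ring

/-- The real span of complex numbers, not all zero, is stable under multiplication by a
nonreal `u` iff these numbers do not lie on one real line. -/
theorem not_forall_exists_real_combination_iff {ι : Type*} [Fintype ι] (g : ι → ℂ)
    (hg : g ≠ 0) (u : ℂ) (hu : u.im ≠ 0) :
    (¬ ∀ x : ι → ℝ, ∃ y : ι → ℝ, ∑ j, g j * (y j : ℂ) = u * ∑ j, g j * (x j : ℂ)) ↔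
      ∃ c : ℂ, c ≠ 0 ∧ ∀ j, (c * g j).im = 0 := by
  classical
  constructor
  · intro h
    by_contra hc
    exact h fun x => exists_real_combination_eq g hg hc _
  · rintro ⟨c, hc, hreal⟩ h
    have him (y : ι → ℝ) : (c * ∑ j, g j * (y j : ℂ)).im = 0 := by
      simp only [Finset.mul_sum, ← mul_assoc, Complex.im_sum, Complex.im_mul_ofReal, hreal,
        zero_mul, Finset.sum_const_zero]
    obtain ⟨k, hk⟩ := Function.ne_iff.mp hg
    obtain ⟨y, hy⟩ := h (Pi.single k 1)
    have hx : ∑ j, g j * ((Pi.single k 1 : ι → ℝ) j : ℂ) = g k := by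
      rw [Finset.sum_eq_single k]
      · simp
      · intro l _ hl
        simp [hl]
      · simp
    have h0 := him y
    rw [hy, hx, mul_left_comm, Complex.mul_im, hreal k, mul_zero, zero_add] at h0
    have hre : (c * g k).re = 0 := (mul_eq_zero.mp h0).resolve_left hu
    exact mul_ne_zero hc hk (Complex.ext hre (hreal k))


/-- At a regular point `z ∈ (ℂ*)ⁿ` of the hypersurface `V = {f = 0}`, the point is
critical for `Log|V` iff it is critical for `Arg|V` iff the logarithmic Gauss map
value `(z₁·∂₁f(z), …, zₙ·∂ₙf(z))` lies (projectively) in `ℝℙⁿ⁻¹`. -/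
theorem crit_log_eq_crit_arg_eq_gauss_real (n : ℕ) (hn : 1 ≤ n)
    (f : MvPolynomial (Fin n) ℂ) (z : Fin n → ℂ)
    (hz : ∀ j, z j ≠ 0) (hfz : MvPolynomial.eval z f = 0)
    (hgrad : (fun j => MvPolynomial.eval z (MvPolynomial.pderiv j f)) ≠ 0)
    (T : Set (Fin n → ℂ))
    (hT : T = {v : Fin n → ℂ | ∑ j, MvPolynomial.eval z (MvPolynomial.pderiv j f) * v j = 0}) :
    [¬ (∀ x : Fin n → ℝ, ∃ v ∈ T, ∀ j, (v j / z j).re = x j),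
     ¬ (∀ x : Fin n → ℝ, ∃ v ∈ T, ∀ j, (v j / z j).im = x j),
     ∃ c : ℂ, c ≠ 0 ∧
       ∀ j, (c * (z j * MvPolynomial.eval z (MvPolynomial.pderiv j f))).im = 0].TFAE := by
  subst hT
  set a : Fin n → ℂ := fun j => MvPolynomial.eval z (MvPolynomial.pderiv j f) with ha
  have hg : (fun j => z j * a j) ≠ 0 := by
    obtain ⟨k, hk⟩ := Function.ne_iff.mp hgrad
    exact Function.ne_iff.mpr ⟨k, mul_ne_zero (hz k) hk⟩
  have hsum (v : Fin n → ℂ) : ∑ j, a j * v j =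
      ∑ j, z j * a j * ((v j / z j).re : ℂ) +
        Complex.I * ∑ j, z j * a j * ((v j / z j).im : ℂ) := by
    rw [Finset.mul_sum, ← Finset.sum_add_distrib]
    refine Finset.sum_congr rfl fun j _ => ?_
    calc a j * v j = z j * a j * (v j / z j) := by field_simp [hz j]
      _ = z j * a j * ((v j / z j).re + (v j / z j).im * Complex.I) := by
        rw [Complex.re_add_im]
      _ = _ := by ring
  have hlift (x y : Fin n → ℝ)
      (h : ∑ j, z j * a j * (x j : ℂ) + Complex.I * ∑ j, z j * a j * (y j : ℂ) = 0) :
      ∃ v ∈ {v : Fin n → ℂ | ∑ j, a j * v j = 0},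
        (∀ j, (v j / z j).re = x j) ∧ ∀ j, (v j / z j).im = y j := by
    have hdiv (j : Fin n) : z j * (x j + y j * Complex.I) / z j = x j + y j * Complex.I :=
      mul_div_cancel_left₀ _ (hz j)
    have hre (j : Fin n) : (z j * (x j + y j * Complex.I) / z j).re = x j := by
      simp [hdiv]
    have him (j : Fin n) : (z j * (x j + y j * Complex.I) / z j).im = y j := by
      simp [hdiv]
    refine ⟨fun j => z j * (x j + y j * Complex.I), ?_, hre, him⟩
    rw [Set.mem_ofPred_eq, hsum]
    simpa only [hre, him] using h
  have hlog := not_forall_exists_real_combination_iff _ hg Complex.I (by simp)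
  have harg := not_forall_exists_real_combination_iff _ hg (-Complex.I) (by simp)
  tfae_have 1 ↔ 3 := by
    rw [← hlog]
    refine not_congr (forall_congr' fun x => ⟨?_, ?_⟩)
    · rintro ⟨v, hv, hvx⟩
      refine ⟨fun j => (v j / z j).im, ?_⟩
      rw [Set.mem_ofPred_eq, hsum] at hv
      simp only [hvx] at hv
      linear_combination (-Complex.I) * hv +
        (∑ j, z j * a j * ((v j / z j).im : ℂ)) * Complex.I_sq
    · rintro ⟨y, hy⟩
      obtain ⟨v, hv, hre, -⟩ := hlift x y (by
        rw [hy]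
        linear_combination (∑ j, z j * a j * (x j : ℂ)) * Complex.I_sq)
      exact ⟨v, hv, hre⟩
  tfae_have 2 ↔ 3 := by
    rw [← harg]
    refine not_congr (forall_congr' fun y => ⟨?_, ?_⟩)
    · rintro ⟨v, hv, hvy⟩
      refine ⟨fun j => (v j / z j).re, ?_⟩
      rw [Set.mem_ofPred_eq, hsum] at hv
      simp only [hvy] at hv
      linear_combination hv
    · rintro ⟨x, hx⟩
      obtain ⟨v, hv, -, him⟩ := hlift x y (by
        rw [hx]
        ring)
      exact ⟨v, hv, him⟩
  tfae_finish
end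

section
/- Let n ≥ 2 and let A, B ∈ ℝⁿ be linearly independent over ℝ. Let H = {W ∈ ℂⁿ : Σⱼ (Aⱼ + i·Bⱼ)·Wⱼ = 0}. Then both ℝ-linear maps H → ℝⁿ given by W ↦ (Re W₁, …, Re Wₙ) and W ↦ (Im W₁, …, Im Wₙ) are surjective. -/
/-- A matrix over a field with linearly independent rows acts surjectively on column vectors. -/
theorem Matrix.mulVec_surjective_of_linearIndependent_row {K m n : Type*} [Field K]
    [Fintype m] [Fintype n] {M : Matrix m n K} (h : LinearIndependent K M.row) :
    Function.Surjective M.mulVec := by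
  have hr : Module.finrank K (LinearMap.range M.mulVecLin) = Module.finrank K (m → K) := by
    rw [Module.finrank_pi]
    exact h.rank_matrix
  exact LinearMap.range_eq_top.mp (Submodule.eq_top_of_finrank_eq hr)

/-- Two linearly independent linear forms on `ℝⁿ` take arbitrary prescribed values. -/
theorem exists_sum_mul_eq_of_linearIndependent_pair {n : ℕ} {A B : Fin n → ℝ}
    (hAB : LinearIndependent ℝ ![A, B]) (s t : ℝ) :
    ∃ y : Fin n → ℝ, ∑ j, A j * y j = s ∧ ∑ j, B j * y j = t := by
  obtain ⟨y, hy⟩ := Matrix.mulVec_surjective_of_linearIndependent_row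
    (M := Matrix.of ![A, B]) hAB ![s, t]
  exact ⟨y, congrFun hy 0, congrFun hy 1⟩

/-- If `A, B ∈ ℝⁿ` are linearly independent, then on the complex hyperplane
`H = {W : Σ (Aⱼ + iBⱼ)Wⱼ = 0}` both the real-part and the imaginary-part
projections to `ℝⁿ` are surjective. -/
theorem re_im_proj_surjective_of_linearIndependent (n : ℕ) (hn : 2 ≤ n)
    (A B : Fin n → ℝ) (hAB : LinearIndependent ℝ ![A, B])
    (H : Set (Fin n → ℂ))
    (hH : H = {W : Fin n → ℂ | ∑ j, ((A j : ℂ) + (B j : ℂ) * Complex.I) * W j = 0}) :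
    (∀ x : Fin n → ℝ, ∃ W ∈ H, ∀ j, (W j).re = x j) ∧
    (∀ x : Fin n → ℝ, ∃ W ∈ H, ∀ j, (W j).im = x j) := by
  have hre : ∀ x : Fin n → ℝ, ∃ W ∈ H, ∀ j, (W j).re = x j := by
    intro x
    obtain ⟨y, hA, hB⟩ := exists_sum_mul_eq_of_linearIndependent_pair hAB
      (-∑ j, B j * x j) (∑ j, A j * x j)
    refine ⟨fun j => ⟨x j, y j⟩, ?_, fun j => rfl⟩
    rw [hH, Set.mem_ofPred_eq]
    apply Complex.ext
    · simp [Finset.sum_sub_distrib, hB]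
    · simp [Finset.sum_add_distrib, hA]
  refine ⟨hre, fun x => ?_⟩
  obtain ⟨W, hW, hx⟩ := hre x
  refine ⟨fun j => W j * Complex.I, ?_, fun j => by simp [hx j]⟩
  rw [hH, Set.mem_ofPred_eq] at hW ⊢
  simp only [← mul_assoc, ← Finset.sum_mul, hW, zero_mul]
end

section
/- Let α, β ∈ (−π, π]. There exist z, w ∈ ℂ∖{0} with z + w + 1 = 0, arg z = α and arg w = β if and only if one of the following holds: (a) 0 < α < π and −π < β < α − π; (b) −π < α < 0 and α + π < β < π; (c) (α, β) ∈ {(π, 0), (0, π), (π, π)}. In particular, the coamoeba of the standard line z + w + 1 = 0 consists of two open triangles in (−π,π]² together with the three points (π,0), (0,π), (π,π). -/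
/-- Polar form of the standard line: a pair of arguments is attained iff the corresponding
unit vectors have a positive combination equal to `-1`. -/
theorem exists_standard_line_iff_exists_pos (α β : ℝ)
    (hα : α ∈ Set.Ioc (-Real.pi) Real.pi) (hβ : β ∈ Set.Ioc (-Real.pi) Real.pi) :
    (∃ z w : ℂ, z ≠ 0 ∧ w ≠ 0 ∧ z + w + 1 = 0 ∧ Complex.arg z = α ∧ Complex.arg w = β) ↔
      ∃ r s : ℝ, 0 < r ∧ 0 < s ∧ r * Real.cos α + s * Real.cos β + 1 = 0 ∧
        r * Real.sin α + s * Real.sin β = 0 := by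
  constructor
  · rintro ⟨z, w, hz, hw, h, rfl, rfl⟩
    refine ⟨‖z‖, ‖w‖, norm_pos_iff.2 hz, norm_pos_iff.2 hw, ?_, ?_⟩
    · simpa using congrArg Complex.re h
    · simpa using congrArg Complex.im h
  · rintro ⟨r, s, hr, hs, hre, him⟩
    have hα' := Complex.arg_mul_cos_add_sin_mul_I hr hα
    have hβ' := Complex.arg_mul_cos_add_sin_mul_I hs hβ
    have ne_zero (t θ : ℝ) (ht : 0 < t) :
        (t : ℂ) * (Complex.cos θ + Complex.sin θ * Complex.I) ≠ 0 := by
      rw [← Complex.exp_mul_I]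
      exact mul_ne_zero (Complex.ofReal_ne_zero.2 ht.ne') (Complex.exp_ne_zero _)
    refine ⟨_, _, ne_zero r α hr, ne_zero s β hs, ?_, hα', hβ'⟩
    have hre' : (r : ℂ) * Complex.cos α + s * Complex.cos β + 1 = 0 := by exact_mod_cast hre
    have him' : (r : ℂ) * Complex.sin α + s * Complex.sin β = 0 := by exact_mod_cast him
    linear_combination hre' + Complex.I * him'

/-- If `sin β` and `sin (α - β)` have the same sign and `sin α` the opposite one, then `-1` is a
positive combination of the unit vectors with arguments `α` and `β`. -/
theorem exists_pos_combination_eq_neg_one {α β : ℝ}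
    (hα : Real.sin α / Real.sin (α - β) < 0) (hβ : 0 < Real.sin β / Real.sin (α - β)) :
    ∃ r s : ℝ, 0 < r ∧ 0 < s ∧ r * Real.cos α + s * Real.cos β + 1 = 0 ∧
      r * Real.sin α + s * Real.sin β = 0 := by
  have hne : Real.sin (α - β) ≠ 0 := by
    intro h
    simp [h] at hα
  refine ⟨_, _, hβ, neg_pos.2 hα, ?_, ?_⟩
  · field_simp
    rw [Real.sin_sub]
    ring
  · ring

/-- Description of the coamoeba of the standard line `z + w + 1 = 0`: a pair of
arguments `(α, β) ∈ (−π, π]²` is attained iff it lies in one of two open triangles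
or is one of the three real points `(π,0), (0,π), (π,π)`. -/
theorem coamoeba_standard_line (α β : ℝ)
    (hα : α ∈ Set.Ioc (-Real.pi) Real.pi) (hβ : β ∈ Set.Ioc (-Real.pi) Real.pi) :
    (∃ z w : ℂ, z ≠ 0 ∧ w ≠ 0 ∧ z + w + 1 = 0 ∧ Complex.arg z = α ∧ Complex.arg w = β) ↔
      ((0 < α ∧ α < Real.pi ∧ -Real.pi < β ∧ β < α - Real.pi) ∨
       (-Real.pi < α ∧ α < 0 ∧ α + Real.pi < β ∧ β < Real.pi) ∨
       ((α, β) = (Real.pi, 0) ∨ (α, β) = (0, Real.pi) ∨ (α, β) = (Real.pi, Real.pi))) := by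
  rw [exists_standard_line_iff_exists_pos α β hα hβ]
  obtain ⟨hα₁, hα₂⟩ := hα
  obtain ⟨hβ₁, hβ₂⟩ := hβ
  simp only [Prod.mk.injEq]
  constructor
  · rintro ⟨r, s, hr, hs, hre, him⟩
    have hsin : s * Real.sin (α - β) = -Real.sin α := by
      rw [Real.sin_sub]
      linear_combination Real.sin α * hre - Real.cos α * him
    have zero_or_pi (h : Real.sin β = 0) : β = 0 ∨ β = Real.pi := by
      rcases lt_trichotomy β 0 with h' | h' | h'
      · exact absurd h (Real.sin_neg_of_neg_of_neg_pi_lt h' hβ₁).ne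
      · exact Or.inl h'
      · refine Or.inr (hβ₂.eq_or_lt.resolve_right fun h'' => ?_)
        exact (Real.sin_pos_of_pos_of_lt_pi h' h'').ne' h
    rcases lt_trichotomy α 0 with hα | rfl | hα
    · have hsα := Real.sin_neg_of_neg_of_neg_pi_lt hα hα₁
      have hsβ : 0 < Real.sin β := by
        by_contra! h
        nlinarith [mul_neg_of_pos_of_neg hr hsα]
      have hβ₀ : 0 < β := by
        by_contra! h
        exact hsβ.not_ge (Real.sin_nonpos_of_nonpos_of_neg_pi_le h hβ₁.le)
      have hβπ : β < Real.pi := hβ₂.lt_of_ne fun h => by simp [h] at hsβ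
      refine Or.inr (Or.inl ⟨hα₁, hα, ?_, hβπ⟩)
      by_contra! h
      have := Real.sin_nonpos_of_nonpos_of_neg_pi_le
        (show α - β ≤ 0 by linarith) (show -Real.pi ≤ α - β by linarith)
      nlinarith
    · have hβ : Real.sin β = 0 := by simpa [hs.ne'] using him
      rcases zero_or_pi hβ with rfl | rfl
      · simp only [Real.cos_zero, mul_one] at hre
        linarith
      · simp
    · rcases hα₂.eq_or_lt with rfl | hα₂
      · have hβ : Real.sin β = 0 := by simpa [hs.ne'] using him
        rcases zero_or_pi hβ with rfl | rfl <;> simp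
      · have hsα := Real.sin_pos_of_pos_of_lt_pi hα hα₂
        have hβ₀ : β < 0 := by
          by_contra! h
          nlinarith [mul_pos hr hsα, Real.sin_nonneg_of_nonneg_of_le_pi h hβ₂]
        refine Or.inl ⟨hα, hα₂, hβ₁, ?_⟩
        by_contra! h
        have := Real.sin_nonneg_of_nonneg_of_le_pi
          (show 0 ≤ α - β by linarith) (show α - β ≤ Real.pi by linarith)
        nlinarith
  · rintro (⟨h₁, h₂, h₃, h₄⟩ | ⟨h₁, h₂, h₃, h₄⟩ | ⟨rfl, rfl⟩ | ⟨rfl, rfl⟩ | ⟨rfl, rfl⟩)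
    · have hsα := Real.sin_pos_of_pos_of_lt_pi h₁ h₂
      have hsβ := Real.sin_neg_of_neg_of_neg_pi_lt (show β < 0 by linarith) h₃
      have hsub : Real.sin (α - β) < 0 := by
        rw [← Real.sin_sub_two_pi]
        exact Real.sin_neg_of_neg_of_neg_pi_lt (by linarith) (by linarith)
      exact exists_pos_combination_eq_neg_one
        (div_neg_of_pos_of_neg hsα hsub) (div_pos_of_neg_of_neg hsβ hsub)
    · have hsα := Real.sin_neg_of_neg_of_neg_pi_lt h₂ h₁
      have hsβ := Real.sin_pos_of_pos_of_lt_pi (show 0 < β by linarith) h₄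
      have hsub : 0 < Real.sin (α - β) := by
        rw [← Real.sin_add_two_pi]
        exact Real.sin_pos_of_pos_of_lt_pi (by linarith) (by linarith)
      exact exists_pos_combination_eq_neg_one
        (div_neg_of_neg_of_pos hsα hsub) (div_pos hsβ hsub)
    · exact ⟨2, 1, by norm_num, by norm_num, by norm_num, by norm_num⟩
    · exact ⟨1, 2, by norm_num, by norm_num, by norm_num, by norm_num⟩
    · exact ⟨1 / 2, 1 / 2, by norm_num, by norm_num, by norm_num, by norm_num⟩
end

section
/- The coamoeba of the standard line z + w + 1 = 0, i.e. the set {(arg z, arg w) ∈ (−π,π]² : z, w ∈ ℂ∖{0}, z + w + 1 = 0}, has Lebesgue measure exactly π² in ℝ²; it is the union of two triangles each of area π²/2, together with a finite set of points. -/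
open MeasureTheory
open scoped ENNReal

/-- The open triangle with vertices `(0, -π)`, `(π, -π)` and `(π, 0)`. -/
def lowerTriangle : Set (ℝ × ℝ) :=
  {q | 0 < q.1 ∧ q.1 < Real.pi ∧ -Real.pi < q.2 ∧ q.2 < q.1 - Real.pi}

/-- The open triangle with vertices `(-π, 0)`, `(-π, π)` and `(0, π)`. -/
def upperTriangle : Set (ℝ × ℝ) :=
  {q | -Real.pi < q.1 ∧ q.1 < 0 ∧ q.1 + Real.pi < q.2 ∧ q.2 < Real.pi}

theorem swap_mem_lowerTriangle {q : ℝ × ℝ} : q.swap ∈ lowerTriangle ↔ q ∈ upperTriangle := by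
  simp only [lowerTriangle, upperTriangle, Set.mem_ofPred_eq, Prod.fst_swap, Prod.snd_swap]
  constructor <;> rintro ⟨h₁, h₂, h₃, h₄⟩ <;> refine ⟨?_, ?_, ?_, ?_⟩ <;> linarith

theorem lowerTriangle_eq_regionBetween :
    lowerTriangle =
      regionBetween (fun _ => -Real.pi) (fun x => x - Real.pi) (Set.Ioo 0 Real.pi) := by
  ext q
  simp [lowerTriangle, regionBetween, and_assoc]

theorem measurableSet_lowerTriangle : MeasurableSet lowerTriangle := by
  rw [lowerTriangle_eq_regionBetween]
  exact measurableSet_regionBetween (by fun_prop) (by fun_prop) measurableSet_Ioo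

theorem volume_lowerTriangle : volume lowerTriangle = ENNReal.ofReal (Real.pi ^ 2 / 2) := by
  have integrableOn {f : ℝ → ℝ} (hf : Continuous f) : IntegrableOn f (Set.Ioo 0 Real.pi) :=
    (hf.integrableOn_Icc (a := 0) (b := Real.pi)).mono_set Set.Ioo_subset_Icc_self
  rw [lowerTriangle_eq_regionBetween, Measure.volume_eq_prod,
    volume_regionBetween_eq_integral (integrableOn (by fun_prop)) (integrableOn (by fun_prop))
      measurableSet_Ioo (fun x hx => by linarith [hx.1]),
    ← integral_Ioc_eq_integral_Ioo, ← intervalIntegral.integral_of_le Real.pi_pos.le]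
  simp

theorem preimage_swap_lowerTriangle : Prod.swap ⁻¹' lowerTriangle = upperTriangle :=
  Set.ext fun _ => swap_mem_lowerTriangle

theorem measurableSet_upperTriangle : MeasurableSet upperTriangle :=
  preimage_swap_lowerTriangle ▸ measurable_swap measurableSet_lowerTriangle

theorem volume_upperTriangle : volume upperTriangle = ENNReal.ofReal (Real.pi ^ 2 / 2) := by
  rw [← preimage_swap_lowerTriangle, ← volume_lowerTriangle]
  exact (Measure.measurePreserving_swap (μ := (volume : Measure ℝ))
    (ν := (volume : Measure ℝ))).measure_preimage measurableSet_lowerTriangle.nullMeasurableSet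

theorem disjoint_lowerTriangle_upperTriangle : Disjoint lowerTriangle upperTriangle :=
  Set.disjoint_left.2 fun _ h h' => h.1.not_gt h'.2.1

/-- The coamoeba of the standard line `z + w + 1 = 0`. -/
def standardLineCoamoeba : Set (ℝ × ℝ) :=
  {q | ∃ z w : ℂ, z ≠ 0 ∧ w ≠ 0 ∧ z + w + 1 = 0 ∧ q = (Complex.arg z, Complex.arg w)}

theorem swap_mem_standardLineCoamoeba {q : ℝ × ℝ} (hq : q ∈ standardLineCoamoeba) :
    q.swap ∈ standardLineCoamoeba := by
  obtain ⟨z, w, hz, hw, h, rfl⟩ := hq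
  exact ⟨w, z, hw, hz, by rw [add_comm w z, h], rfl⟩

theorem arg_mem_lowerTriangle {z w : ℂ} (hz : 0 < z.im) (h : z + w + 1 = 0) :
    (z.arg, w.arg) ∈ lowerTriangle := by
  have him : z.im + w.im = 0 := by simpa using congrArg Complex.im h
  have hre : z.re + w.re + 1 = 0 := by simpa using congrArg Complex.re h
  have hw : w.im < 0 := by linarith
  have hz₀ : 0 < z.arg := (Complex.arg_nonneg_iff.2 hz.le).lt_of_ne fun h₀ =>
    hz.ne' (Complex.arg_eq_zero_iff.1 h₀.symm).2
  have hzπ : z.arg < Real.pi := (Complex.arg_le_pi z).lt_of_ne fun h₀ =>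
    hz.ne' (Complex.arg_eq_pi_iff.1 h₀).2
  have hw₀ : w.arg < 0 := Complex.arg_neg_iff.2 hw
  refine ⟨hz₀, hzπ, Complex.neg_pi_lt_arg w, ?_⟩
  by_contra! hle
  have hsin : 0 ≤ Real.sin (z.arg - w.arg) :=
    Real.sin_nonneg_of_nonneg_of_le_pi (by linarith) (by linarith)
  have key : ‖z‖ * ‖w‖ * Real.sin (z.arg - w.arg) = z.im * w.re - z.re * w.im := by
    rw [Real.sin_sub]
    linear_combination (‖w‖ * Real.cos w.arg) * Complex.norm_mul_sin_arg z
      + z.im * Complex.norm_mul_cos_arg w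
      - (‖w‖ * Real.sin w.arg) * Complex.norm_mul_cos_arg z - z.re * Complex.norm_mul_sin_arg w
  have hnonneg : 0 ≤ ‖z‖ * ‖w‖ * Real.sin (z.arg - w.arg) := by positivity
  have hneg : z.im * w.re - z.re * w.im = -z.im := by
    linear_combination z.im * hre - z.re * him
  linarith

theorem lowerTriangle_subset_standardLineCoamoeba : lowerTriangle ⊆ standardLineCoamoeba := by
  rintro ⟨θ, φ⟩ ⟨hθ₀, hθπ, hφπ, hφ⟩
  dsimp only at hθ₀ hθπ hφπ hφ
  have hsθ : 0 < Real.sin θ := Real.sin_pos_of_pos_of_lt_pi hθ₀ hθπ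
  have hsφ : Real.sin φ < 0 := Real.sin_neg_of_neg_of_neg_pi_lt (by linarith) hφπ
  have hs : Real.sin (θ - φ) < 0 := by
    rw [← neg_pos, ← Real.sin_sub_pi]
    exact Real.sin_pos_of_pos_of_lt_pi (by linarith) (by linarith)
  have hr : 0 < Real.sin φ / Real.sin (θ - φ) := div_pos_of_neg_of_neg hsφ hs
  have ht : 0 < -Real.sin θ / Real.sin (θ - φ) := div_pos_of_neg_of_neg (by linarith) hs
  have hargz := Complex.arg_mul_cos_add_sin_mul_I hr (θ := θ) ⟨by linarith, hθπ.le⟩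
  have hargw := Complex.arg_mul_cos_add_sin_mul_I ht (θ := φ) ⟨hφπ, by linarith⟩
  refine ⟨_, _, ?_, ?_, ?_, Prod.ext hargz.symm hargw.symm⟩
  · intro h
    rw [h, Complex.arg_zero] at hargz
    linarith
  · intro h
    rw [h, Complex.arg_zero] at hargw
    linarith
  · have hs' := hs.ne
    apply Complex.ext
    · simp [-Complex.ofReal_div, -Complex.ofReal_neg, ← Complex.ofReal_cos, ← Complex.ofReal_sin]
      field_simp
      rw [Real.sin_sub]
      ring
    · simp [-Complex.ofReal_div, -Complex.ofReal_neg, ← Complex.ofReal_cos, ← Complex.ofReal_sin]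
      field_simp
      ring

theorem upperTriangle_subset_standardLineCoamoeba : upperTriangle ⊆ standardLineCoamoeba :=
  fun q hq => q.swap_swap ▸ swap_mem_standardLineCoamoeba
    (lowerTriangle_subset_standardLineCoamoeba (swap_mem_lowerTriangle.2 hq))

theorem arg_mem_of_im_eq_zero {z : ℂ} (hz : z.im = 0) : z.arg ∈ ({0, Real.pi} : Set ℝ) := by
  rcases le_or_gt 0 z.re with h | h
  · exact Or.inl (Complex.arg_eq_zero_iff.2 ⟨h, hz⟩)
  · exact Or.inr (Complex.arg_eq_pi_iff.2 ⟨h, hz⟩)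

theorem standardLineCoamoeba_eq :
    standardLineCoamoeba = lowerTriangle ∪ upperTriangle ∪
      (standardLineCoamoeba ∩ ({0, Real.pi} ×ˢ {0, Real.pi})) := by
  refine Set.Subset.antisymm ?_ (Set.union_subset (Set.union_subset
    lowerTriangle_subset_standardLineCoamoeba upperTriangle_subset_standardLineCoamoeba)
    Set.inter_subset_left)
  intro q hq
  obtain ⟨z, w, -, -, h, rfl⟩ := id hq
  have him : z.im + w.im = 0 := by simpa using congrArg Complex.im h
  rcases lt_trichotomy z.im 0 with hz | hz | hz
  · exact Or.inl (Or.inr (swap_mem_lowerTriangle.1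
      (arg_mem_lowerTriangle (by linarith) (by rw [add_comm w z, h]))))
  · exact Or.inr ⟨hq, arg_mem_of_im_eq_zero hz, arg_mem_of_im_eq_zero (by linarith)⟩
  · exact Or.inl (Or.inl (arg_mem_lowerTriangle hz h))

/-- The coamoeba of the standard line `z + w + 1 = 0` has Lebesgue measure `π²`:
it is the union of two triangles, each of area `π²/2`, together with a finite set. -/
theorem coamoeba_standard_line_area
    (S : Set (ℝ × ℝ))
    (hS : S = {q : ℝ × ℝ | ∃ z w : ℂ, z ≠ 0 ∧ w ≠ 0 ∧ z + w + 1 = 0 ∧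
        q = (Complex.arg z, Complex.arg w)}) :
    volume S = ENNReal.ofReal (Real.pi ^ 2) ∧
    ∃ F : Set (ℝ × ℝ), F.Finite ∧
      S = {q : ℝ × ℝ | 0 < q.1 ∧ q.1 < Real.pi ∧ -Real.pi < q.2 ∧ q.2 < q.1 - Real.pi} ∪
          {q : ℝ × ℝ | -Real.pi < q.1 ∧ q.1 < 0 ∧ q.1 + Real.pi < q.2 ∧ q.2 < Real.pi} ∪ F ∧
      volume {q : ℝ × ℝ | 0 < q.1 ∧ q.1 < Real.pi ∧ -Real.pi < q.2 ∧ q.2 < q.1 - Real.pi}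
        = ENNReal.ofReal (Real.pi ^ 2 / 2) ∧
      volume {q : ℝ × ℝ | -Real.pi < q.1 ∧ q.1 < 0 ∧ q.1 + Real.pi < q.2 ∧ q.2 < Real.pi}
        = ENNReal.ofReal (Real.pi ^ 2 / 2) := by
  change S = standardLineCoamoeba at hS
  subst hS
  have hF : (standardLineCoamoeba ∩ ({0, Real.pi} ×ˢ {0, Real.pi})).Finite :=
    ((Set.toFinite _).prod (Set.toFinite _)).inter_of_right _
  refine ⟨?_, _, hF, standardLineCoamoeba_eq, volume_lowerTriangle, volume_upperTriangle⟩
  rw [standardLineCoamoeba_eq,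
    measure_congr (union_ae_eq_left_of_ae_eq_empty (ae_eq_empty.2 (hF.measure_zero _))),
    measure_union disjoint_lowerTriangle_upperTriangle measurableSet_upperTriangle,
    volume_lowerTriangle, volume_upperTriangle,
    ← ENNReal.ofReal_add (by positivity) (by positivity), add_halves]
end

section
/- Let L be a 2×2 integer matrix with determinant 1 and let S = {(arg z, arg w) ∈ (−π,π]² : z, w ∈ ℂ∖{0}, z + w + 1 = 0} be the coamoeba of the standard line. Then the closure in the torus ℝ²/(πℤ)² of the image of S under the map x ↦ (ᵗL)⁻¹·x followed by the quotient projection ℝ² → ℝ²/(πℤ)² is the whole torus ℝ²/(πℤ)². -/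
/-- A nonzero real multiple of `exp (i θ)` has argument congruent to `θ` modulo `π`. -/
theorem exists_int_arg_real_mul_cos_add_sin_mul_I {a : ℝ} (ha : a ≠ 0) (θ : ℝ) :
    ∃ k : ℤ, Complex.arg (⟨a * Real.cos θ, a * Real.sin θ⟩ : ℂ) = θ + k * Real.pi := by
  set z : ℂ := ⟨a * Real.cos θ, a * Real.sin θ⟩ with hz
  have hre : ‖z‖ * Real.cos z.arg = a * Real.cos θ := Complex.norm_mul_cos_arg z
  have him : ‖z‖ * Real.sin z.arg = a * Real.sin θ := Complex.norm_mul_sin_arg z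
  have hz0 : ‖z‖ ≠ 0 := by
    intro h
    rw [h, zero_mul] at hre him
    have hc : Real.cos θ = 0 := by simpa [ha] using hre.symm
    have hs : Real.sin θ = 0 := by simpa [ha] using him.symm
    simpa [hc, hs] using Real.sin_sq_add_cos_sq θ
  have hsin : Real.sin (z.arg - θ) = 0 := by
    apply mul_left_cancel₀ hz0
    rw [Real.sin_sub]
    linear_combination Real.cos θ * him - Real.sin θ * hre
  obtain ⟨k, hk⟩ := Real.sin_eq_zero_iff.1 hsin
  exact ⟨k, by linarith⟩

/-- Modulo `π`, the coamoeba of the standard line contains every `(α, β)` with `sin α`, `sin β`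
and `sin (β - α)` nonzero. -/
theorem exists_add_add_one_eq_zero_arg_eq_add_int_mul_pi {α β : ℝ} (hα : Real.sin α ≠ 0)
    (hβ : Real.sin β ≠ 0) (hαβ : Real.sin (β - α) ≠ 0) :
    ∃ z w : ℂ, z ≠ 0 ∧ w ≠ 0 ∧ z + w + 1 = 0 ∧
      (∃ k : ℤ, z.arg = α + k * Real.pi) ∧ ∃ l : ℤ, w.arg = β + l * Real.pi := by
  have ha : -Real.sin β / Real.sin (β - α) ≠ 0 := div_ne_zero (neg_ne_zero.2 hβ) hαβ
  have hb : Real.sin α / Real.sin (β - α) ≠ 0 := div_ne_zero hα hαβ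
  refine ⟨⟨-Real.sin β / Real.sin (β - α) * Real.cos α,
      -Real.sin β / Real.sin (β - α) * Real.sin α⟩,
    ⟨Real.sin α / Real.sin (β - α) * Real.cos β,
      Real.sin α / Real.sin (β - α) * Real.sin β⟩, ?_, ?_, ?_,
    exists_int_arg_real_mul_cos_add_sin_mul_I ha α,
    exists_int_arg_real_mul_cos_add_sin_mul_I hb β⟩
  · exact fun h => mul_ne_zero ha hα (congrArg Complex.im h)
  · exact fun h => mul_ne_zero hb hβ (congrArg Complex.im h)
  · apply Complex.ext
    · simp only [Complex.add_re, Complex.one_re, Complex.zero_re]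
      field_simp
      rw [Real.sin_sub]
      ring
    · simp only [Complex.add_im, Complex.one_im, Complex.zero_im]
      ring

theorem Real.countable_setOf_sin_eq_zero : {t : ℝ | Real.sin t = 0}.Countable := by
  refine (Set.countable_range fun n : ℤ => (n : ℝ) * Real.pi).mono fun t ht => ?_
  exact Real.sin_eq_zero_iff.1 ht

theorem dense_setOf_sin_ne_zero :
    Dense {x : Fin 2 → ℝ | Real.sin (x 0) ≠ 0 ∧ Real.sin (x 1) ≠ 0 ∧
      Real.sin (x 1 - x 0) ≠ 0} := by
  intro x
  let γ : ℝ → Fin 2 → ℝ := fun t => ![x 0 + t, x 1 + 2 * t]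
  have hγ : Continuous γ := by
    refine continuous_pi fun i => ?_
    fin_cases i <;> simp only [γ] <;> simp <;> fun_prop
  have hγ0 : γ 0 = x := by
    ext i
    fin_cases i <;> simp [γ]
  have hcount (f : ℝ → ℝ) (hf : Function.Injective f) :
      {t : ℝ | Real.sin (f t) = 0}.Countable :=
    Real.countable_setOf_sin_eq_zero.preimage_of_injOn hf.injOn
  have h₀ := hcount (fun t => x 0 + t) (add_right_injective _)
  have h₁ := hcount (fun t => x 1 + 2 * t) fun s t h => by
    simpa using h
  have h₂ := hcount (fun t => x 1 + 2 * t - (x 0 + t)) fun s t h => by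
    dsimp only at h
    linarith
  have hdense := ((h₀.union h₁).union h₂).dense_compl ℝ
  rw [← hγ0]
  refine map_mem_closure hγ (hdense 0) fun t ht => ?_
  simpa [γ, not_or, and_assoc] using ht

theorem AddCircle.coe_add_int_mul (p x : ℝ) (k : ℤ) :
    ((x + k * p : ℝ) : AddCircle p) = x := by
  have h : ((k * p : ℝ) : AddCircle p) = 0 := AddCircle.coe_eq_zero_iff p |>.2 ⟨k, by simp⟩
  rw [AddCircle.coe_add, h, add_zero]


/-- For `L ∈ SL₂(ℤ)`, the image in the torus `ℝ²/(πℤ)²` of the coamoeba of the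
standard line `z + w + 1 = 0` under `(ᵗL)⁻¹` is dense: its closure is the whole torus. -/
theorem closure_image_coamoeba_standard_line_eq_univ
    (L : Matrix (Fin 2) (Fin 2) ℤ) (hL : L.det = 1)
    (M : Matrix (Fin 2) (Fin 2) ℝ) (hM : M = (L.transpose⁻¹).map (Int.cast : ℤ → ℝ))
    (S : Set (Fin 2 → ℝ))
    (hS : S = {x : Fin 2 → ℝ | ∃ z w : ℂ, z ≠ 0 ∧ w ≠ 0 ∧ z + w + 1 = 0 ∧
        x 0 = Complex.arg z ∧ x 1 = Complex.arg w}) :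
    closure ((fun x : Fin 2 → ℝ =>
        ((M.mulVec x 0 : AddCircle Real.pi), (M.mulVec x 1 : AddCircle Real.pi))) '' S)
      = (Set.univ : Set (AddCircle Real.pi × AddCircle Real.pi)) := by
  have hunit : IsUnit L.transpose.det := by simp [Matrix.det_transpose, hL]
  set f : (Fin 2 → ℝ) → AddCircle Real.pi × AddCircle Real.pi := fun x =>
    ((M.mulVec x 0 : AddCircle Real.pi), (M.mulVec x 1 : AddCircle Real.pi)) with hf
  have hcont : Continuous f := by
    have hM' : Continuous fun x : Fin 2 → ℝ => M.mulVec x :=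
      continuous_const.matrix_mulVec continuous_id
    exact ((AddCircle.continuous_mk' _).comp ((continuous_apply 0).comp hM')).prodMk
      ((AddCircle.continuous_mk' _).comp ((continuous_apply 1).comp hM'))
  have hsurj : Function.Surjective f := by
    rintro ⟨p, q⟩
    obtain ⟨a, rfl⟩ := QuotientAddGroup.mk_surjective p
    obtain ⟨b, rfl⟩ := QuotientAddGroup.mk_surjective q
    have hMinv : M * L.transpose.map (Int.cast : ℤ → ℝ) = 1 := by
      rw [hM]
      change (Int.castRingHom ℝ).mapMatrix L.transpose⁻¹ *
        (Int.castRingHom ℝ).mapMatrix L.transpose = 1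
      rw [← map_mul, Matrix.nonsing_inv_mul _ hunit, map_one]
    refine ⟨(L.transpose.map (Int.cast : ℤ → ℝ)).mulVec ![a, b], ?_⟩
    simp only [hf, Matrix.mulVec_mulVec, hMinv, Matrix.one_mulVec]
    rfl
  rw [← dense_iff_closure_eq]
  refine (hsurj.denseRange.dense_image hcont dense_setOf_sin_ne_zero).mono ?_
  rintro _ ⟨x, ⟨h₀, h₁, h₂⟩, rfl⟩
  obtain ⟨z, w, hz, hw, hzw, ⟨k, hk⟩, ⟨l, hl⟩⟩ :=
    exists_add_add_one_eq_zero_arg_eq_add_int_mul_pi h₀ h₁ h₂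
  have hcoe (i : Fin 2) : ((M.mulVec ![z.arg, w.arg] i : ℝ) : AddCircle Real.pi) =
      (M.mulVec x i : ℝ) := by
    rw [← AddCircle.coe_add_int_mul Real.pi (M.mulVec x i)
      (L.transpose⁻¹ i 0 * k + L.transpose⁻¹ i 1 * l)]
    congr 1
    simp only [hM, hk, hl, Matrix.mulVec, dotProduct, Fin.sum_univ_two, Matrix.map_apply,
      Matrix.cons_val_zero, Matrix.cons_val_one]
    push_cast
    ring
  refine ⟨![z.arg, w.arg], ?_, Prod.ext (hcoe 0) (hcoe 1)⟩
  rw [hS]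
  exact ⟨z, w, hz, hw, hzw, rfl, rfl⟩
end
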